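/- Let n, m ≥ 1 be integers and ρ1, ρ2, ρ12 real numbers with ρ1 ≠ 1, ρ2 ≠ 1, 1+(n−1)ρ1 ≠ 0, and E := (1+(n−1)ρ1)·(1+(m−1)ρ2) − m·n·ρ12² ≠ 0. Then the m×m matrix G := (ρ2·J_m + (1−ρ2)·I_m) − (ρ12·J_{m,n})·(ρ1·J_n + (1−ρ1)·I_n)⁻¹·(ρ12·J_{n,m}) is invertible and G⁻¹ · 𝟙 = ((1+(n−1)ρ1)/E) · 𝟙, i.e., every row sum of G⁻¹ equals (1+(n−1)ρ1)/E. -/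

import Mathlib

open Matrix

noncomputable section

/-- The all-ones matrix. -/
def J (a b : ℕ) : Matrix (Fin a) (Fin b) ℝ := Matrix.of fun _ _ => 1

theorem J_app (a b : ℕ) (i : Fin a) (j : Fin b) : J a b i j = 1 := rfl

theorem J_mul_J (a b c : ℕ) : J a b * J b c = (b : ℝ) • J a c := by
  ext i j
  simp [J_app, Matrix.mul_apply]

theorem aux_inv (k : ℕ) (a b : ℝ) (hb : b ≠ 0) (hab : b + k * a ≠ 0) :
    (a • J k k + b • (1 : Matrix (Fin k) (Fin k) ℝ)) *
      ((-(a / (b * (b + k * a)))) • J k k + b⁻¹ • (1 : Matrix (Fin k) (Fin k) ℝ)) = 1 := by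
  simp only [Matrix.add_mul, Matrix.mul_add, Matrix.smul_mul, Matrix.mul_smul, smul_add, J_mul_J, Matrix.mul_one, Matrix.one_mul, smul_smul]
  rw [inv_mul_cancel₀ hb, one_smul]
  have : -(a / (b * (b + k * a))) * a * k + -(a / (b * (b + k * a))) * b + b⁻¹ * a = 0 := by
    generalize hs : b + k * a = s at *
    field_simp
    linear_combination (-a) * hs
  ext i j
  simp only [Matrix.add_apply, Matrix.smul_apply, smul_eq_mul, J_app]
  linear_combination this

theorem aux_isUnit (k : ℕ) (a b : ℝ) (hb : b ≠ 0) (hab : b + k * a ≠ 0) :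
    IsUnit (a • J k k + b • (1 : Matrix (Fin k) (Fin k) ℝ)) :=
  (Matrix.isUnit_iff_isUnit_det _).2 (Matrix.isUnit_det_of_right_inverse (aux_inv k a b hb hab))

theorem aux_inv_mul (k l : ℕ) (a b : ℝ) (hb : b ≠ 0) (hab : b + k * a ≠ 0) :
    (a • J k k + b • (1 : Matrix (Fin k) (Fin k) ℝ))⁻¹ * J k l = (b + k * a)⁻¹ • J k l := by
  rw [Matrix.inv_eq_right_inv (aux_inv k a b hb hab)]
  simp only [Matrix.add_mul, Matrix.smul_mul, J_mul_J, Matrix.one_mul, smul_smul]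
  rw [← add_smul]
  congr 1
  generalize hs : b + k * a = s at *
  field_simp
  linear_combination -hs

theorem stmt_6 (n m : ℕ) (hn : 1 ≤ n) (hm : 1 ≤ m) (ρ1 ρ2 ρ12 : ℝ)
    (h1 : ρ1 ≠ 1) (h2 : ρ2 ≠ 1)
    (hD1 : 1 + ((n : ℝ) - 1) * ρ1 ≠ 0)
    (hE : (1 + ((n : ℝ) - 1) * ρ1) * (1 + ((m : ℝ) - 1) * ρ2)
        - (m : ℝ) * (n : ℝ) * ρ12 ^ 2 ≠ 0) :
    IsUnit ((ρ2 • J m m + (1 - ρ2) • (1 : Matrix (Fin m) (Fin m) ℝ))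
        - (ρ12 • J m n) * (ρ1 • J n n + (1 - ρ1) • (1 : Matrix (Fin n) (Fin n) ℝ))⁻¹ *
          (ρ12 • J n m)) ∧
    ((ρ2 • J m m + (1 - ρ2) • (1 : Matrix (Fin m) (Fin m) ℝ))
        - (ρ12 • J m n) * (ρ1 • J n n + (1 - ρ1) • (1 : Matrix (Fin n) (Fin n) ℝ))⁻¹ *
          (ρ12 • J n m))⁻¹ *ᵥ (fun _ => 1)
      = ((1 + ((n : ℝ) - 1) * ρ1) /
          ((1 + ((n : ℝ) - 1) * ρ1) * (1 + ((m : ℝ) - 1) * ρ2)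
            - (m : ℝ) * (n : ℝ) * ρ12 ^ 2)) • (fun _ => (1 : ℝ)) := by
  have hb1 : 1 - ρ1 ≠ 0 := sub_ne_zero.2 h1.symm
  have hb2 : 1 - ρ2 ≠ 0 := sub_ne_zero.2 h2.symm
  have e1 : (1 - ρ1) + n * ρ1 = 1 + ((n : ℝ) - 1) * ρ1 := by ring
  generalize hd : 1 + ((n : ℝ) - 1) * ρ1 = d at *
  have hG : (ρ2 • J m m + (1 - ρ2) • (1 : Matrix (Fin m) (Fin m) ℝ))
        - (ρ12 • J m n) * (ρ1 • J n n + (1 - ρ1) • (1 : Matrix (Fin n) (Fin n) ℝ))⁻¹ *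
          (ρ12 • J n m) = (ρ2 - ρ12 ^ 2 * n / d) • J m m
            + (1 - ρ2) • (1 : Matrix (Fin m) (Fin m) ℝ) := by
    rw [Matrix.mul_assoc, Matrix.mul_smul, aux_inv_mul n m ρ1 _ hb1 (by rwa [e1]), e1]
    simp only [Matrix.smul_mul, Matrix.mul_smul, J_mul_J, smul_smul]
    ext i j
    simp only [Matrix.add_apply, Matrix.sub_apply, Matrix.smul_apply, smul_eq_mul, J_app]
    ring
  rw [hG]
  have e2 : (1 - ρ2) + m * (ρ2 - ρ12 ^ 2 * n / d) =
      (d * (1 + ((m : ℝ) - 1) * ρ2) - m * n * ρ12 ^ 2) / d := by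
    field_simp
    ring
  have hne : (1 - ρ2) + m * (ρ2 - ρ12 ^ 2 * n / d) ≠ 0 := by
    rw [e2]
    exact div_ne_zero hE hD1
  refine ⟨aux_isUnit _ _ _ hb2 hne, ?_⟩
  have key := aux_inv_mul m 1 _ _ hb2 hne
  rw [e2, inv_div] at key
  ext i
  have := congrFun (congrFun key i) 0
  simpa [J_app, Matrix.mul_apply, Matrix.mulVec, dotProduct] using this
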